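/- arXiv:1301.0408 — 2 statements merged into one kernel-verified Lean document; each statement's English description precedes it below -/
import Mathlib

section
/- Cost of a wasted δ⁻ excursion (Lemma 2.5): Assume V satisfies Assumption 1. There exists C < ∞ such that for every M < ∞ and δ ∈ (0, 1/2) there exists ℓ* < ∞ with the following property. For every ℓ ≥ ℓ* and all u₋, u₊ ∈ [−M, M], let A^bc be the set of continuously differentiable u : ℝ → ℝ with u(−2ℓ) = u₋ and u(2ℓ) = u₊, and let A₀^bc be the set of u ∈ A^bc having a wasted δ⁻ excursion on (−ℓ, ℓ). Then inf_{u ∈ A₀^bc} E_{(−2ℓ,2ℓ)}(u) − inf_{u ∈ A^bc} E_{(−2ℓ,2ℓ)}(u) ≥ c₀ − C·δ. -/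
open MeasureTheory

/-- Assumption 1: `V` is smooth, even, nonnegative, and on `(0,∞)` it vanishes only at `1`,
its derivative vanishes only at `1`, `V''(1) > 0`, and `V` grows at least like `u^{1+β}`. -/
structure Assumption1 (V : ℝ → ℝ) : Prop where
  smooth : ContDiff ℝ (⊤ : ℕ∞) V
  even : ∀ u : ℝ, V (-u) = V u
  nonneg : ∀ u : ℝ, 0 ≤ V u
  zero_iff : ∀ u : ℝ, 0 < u → (V u = 0 ↔ u = 1)
  deriv_zero_iff : ∀ u : ℝ, 0 < u → (deriv V u = 0 ↔ u = 1)
  second_deriv_pos : 0 < deriv (deriv V) 1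
  growth : ∃ C : ℝ, 0 < C ∧ ∃ β : ℝ, 0 < β ∧ ∀ u : ℝ, C ≤ u → u ^ (1 + β) / C ≤ V u

/-- The energy of `u` on `(a,b)`: `E_{(a,b)}(u) = ∫_a^b ((1/2) u'² + V(u))`. -/
noncomputable def energy (V : ℝ → ℝ) (a b : ℝ) (u : ℝ → ℝ) : ℝ :=
  ∫ x in a..b, ((1/2) * (deriv u x)^2 + V (u x))

/-- The transition energy `c₀ = ∫_{-1}^{1} √(2 V(s)) ds`. -/
noncomputable def c0 (V : ℝ → ℝ) : ℝ := ∫ s in (-1:ℝ)..1, Real.sqrt (2 * V s)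

/-- `u` has a wasted `δ⁻` excursion on `(−ℓ, ℓ)`. -/
def HasWastedMinusExcursion (δ ℓ : ℝ) (u : ℝ → ℝ) : Prop :=
  ∃ xm x0 xp : ℝ, -ℓ ≤ xm ∧ xm < x0 ∧ x0 < xp ∧ xp ≤ ℓ ∧ |u x0| ≤ δ ∧
    ((|u xm - 1| ≤ δ ∧ |u xp - 1| ≤ δ) ∨ (|u xm + 1| ≤ δ ∧ |u xp + 1| ≤ δ))


lemma glue_hasDeriv {f g f' g' : ℝ → ℝ} {c : ℝ} (hf : ∀ x, HasDerivAt f (f' x) x)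
    (hg : ∀ x, HasDerivAt g (g' x) x) (h : f c = g c) (h' : f' c = g' c) (x : ℝ) :
    HasDerivAt (fun x => if x ≤ c then f x else g x) (if x ≤ c then f' x else g' x) x := by
  rcases lt_trichotomy x c with hx | hx | hx
  · rw [if_pos hx.le]
    refine (hf x).congr_of_eventuallyEq ?_
    filter_upwards [Iio_mem_nhds hx] with y hy
    rw [if_pos (le_of_lt hy)]
  · subst hx
    rw [if_pos le_rfl]
    have h1 : HasDerivWithinAt (fun y => if y ≤ x then f y else g y) (f' x) (Set.Iic x) x := by
      refine (hf x).hasDerivWithinAt.congr (fun y hy => if_pos hy) (if_pos le_rfl)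
    have h2 : HasDerivWithinAt (fun y => if y ≤ x then f y else g y) (f' x) (Set.Ici x) x := by
      rw [h']
      refine (hg x).hasDerivWithinAt.congr (fun y hy => ?_) ?_
      · rcases eq_or_lt_of_le (show x ≤ y from hy) with e | e
        · subst e; simp [h]
        · simp [not_le.2 e]
      · simp [h]
    have h3 := h1.union h2
    rw [Set.Iic_union_Ici] at h3
    exact h3.hasDerivAt Filter.univ_mem
  · rw [if_neg (not_le.2 hx)]
    refine (hg x).congr_of_eventuallyEq ?_
    filter_upwards [Ioi_mem_nhds hx] with y hy
    rw [if_neg (not_le.2 hy)]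

lemma glue_cont {f g : ℝ → ℝ} {c : ℝ} (hf : Continuous f) (hg : Continuous g) (h : f c = g c) :
    Continuous (fun x => if x ≤ c then f x else g x) := by
  refine Continuous.if_le hf hg continuous_id continuous_const ?_
  rintro x rfl
  exact h

lemma psq_hasDeriv (x : ℝ) : HasDerivAt (fun t : ℝ => (max t 0)^2) (2 * max x 0) x := by
  have h := glue_hasDeriv (f := fun _ => (0:ℝ)) (g := fun t => t^2) (f' := fun _ => 0)
    (g' := fun t => 2 * t) (c := 0) (fun x => hasDerivAt_const x _)
    (fun x => by simpa using hasDerivAt_pow 2 x) (by simp) (by simp) x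
  convert h using 1
  · funext t
    split_ifs with ht
    · simp [max_eq_right ht]
    · simp [max_eq_left (not_le.1 ht).le]
  · split_ifs with ht
    · simp [max_eq_right ht]
    · simp [max_eq_left (not_le.1 ht).le]

/-- smoothed ramp -/
noncomputable def ramp (d t : ℝ) : ℝ := ((max t 0)^2 - (max (t - d) 0)^2) / (2 * d)
/-- derivative of the smoothed ramp -/
noncomputable def dramp (d t : ℝ) : ℝ := (max t 0 - max (t - d) 0) / d

lemma ramp_hasDeriv {d : ℝ} (hd : 0 < d) (x : ℝ) : HasDerivAt (ramp d) (dramp d x) x := by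
  have h1 := psq_hasDeriv x
  have h2 := (psq_hasDeriv (x - d)).comp x ((hasDerivAt_id x).sub_const d)
  have h3 := (h1.sub h2).div_const (2 * d)
  refine h3.congr_deriv ?_
  unfold dramp
  field_simp

lemma dramp_cont (d : ℝ) : Continuous (dramp d) := by unfold dramp; fun_prop

lemma ramp_nonpos {d t : ℝ} (hd : 0 < d) (ht : t ≤ 0) : ramp d t = 0 := by
  unfold ramp; rw [max_eq_right ht, max_eq_right (by linarith)]; simp

lemma dramp_nonpos {d t : ℝ} (hd : 0 < d) (ht : t ≤ 0) : dramp d t = 0 := by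
  unfold dramp; rw [max_eq_right ht, max_eq_right (by linarith)]; simp

lemma ramp_large {d t : ℝ} (hd : 0 < d) (ht : d ≤ t) : ramp d t = t - d / 2 := by
  unfold ramp; rw [max_eq_left (by linarith), max_eq_left (by linarith)]; field_simp; ring

lemma dramp_large {d t : ℝ} (hd : 0 < d) (ht : d ≤ t) : dramp d t = 1 := by
  unfold dramp; rw [max_eq_left (by linarith), max_eq_left (by linarith)]; field_simp; ring

lemma ramp_mid {d t : ℝ} (hd : 0 < d) (h0 : 0 ≤ t) (ht : t ≤ d) : ramp d t = t^2 / (2*d) := by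
  unfold ramp; rw [max_eq_left (by linarith), max_eq_right (by linarith)]; simp

lemma dramp_nonneg {d t : ℝ} (hd : 0 < d) : 0 ≤ dramp d t := by
  unfold dramp
  apply div_nonneg _ hd.le
  have : max (t - d) 0 ≤ max t 0 := max_le_max (by linarith) le_rfl
  linarith

lemma dramp_le_one {d t : ℝ} (hd : 0 < d) : dramp d t ≤ 1 := by
  unfold dramp
  rw [div_le_one hd]
  have : max t 0 ≤ max (t - d) 0 + d := 
    max_le (by linarith [le_max_left (t-d) 0]) (by linarith [le_max_right (t-d) 0])
  linarith

/-- the folding map -/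
noncomputable def fold (d s : ℝ) : ℝ :=
  1 - d - d / 2 + ramp d (s - (1 - 2 * d)) + ramp d (-s - (1 - 2 * d))
/-- derivative of the folding map -/
noncomputable def dfold (d s : ℝ) : ℝ :=
  dramp d (s - (1 - 2 * d)) - dramp d (-s - (1 - 2 * d))

lemma fold_hasDeriv {d : ℝ} (hd : 0 < d) (x : ℝ) : HasDerivAt (fold d) (dfold d x) x := by
  have h1 := (ramp_hasDeriv hd (x - (1 - 2*d))).comp x ((hasDerivAt_id x).sub_const (1 - 2*d))
  have h2 := (ramp_hasDeriv hd (-x - (1 - 2*d))).comp x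
    ((hasDerivAt_id x).neg.sub_const (1 - 2*d))
  have h3 := (h1.const_add (1 - d - d / 2)).add h2
  refine h3.congr_deriv ?_
  unfold dfold
  ring

lemma dfold_cont (d : ℝ) : Continuous (dfold d) := by
  have := dramp_cont d
  unfold dfold; fun_prop

lemma fold_even (d s : ℝ) : fold d (-s) = fold d s := by unfold fold; rw [neg_neg]; ring
lemma fold_abs (d s : ℝ) : fold d |s| = fold d s := by
  rcases abs_choice s with h | h <;> rw [h]
  exact fold_even d s

lemma fold_pos {d s : ℝ} (hd : 0 < d) (hd' : d < 1/4) (hs : 0 ≤ s) :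
    fold d s = 1 - d - d / 2 + ramp d (s - (1 - 2 * d)) := by
  unfold fold; rw [ramp_nonpos hd (t := -s - _) (by linarith)]; ring

lemma fold_large {d s : ℝ} (hd : 0 < d) (hd' : d < 1/4) (hs : 1 - d ≤ s) : fold d s = s := by
  rw [fold_pos hd hd' (by linarith), ramp_large hd (by linarith)]; ring

lemma dfold_large {d s : ℝ} (hd : 0 < d) (hd' : d < 1/4) (hs : 1 - d ≤ s) : dfold d s = 1 := by
  unfold dfold
  rw [dramp_large hd (by linarith), dramp_nonpos hd (by linarith)]; ring

lemma fold_small {d s : ℝ} (hd : 0 < d) (hs : |s| ≤ 1 - 2 * d) : fold d s = 1 - d - d/2 := by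
  have := abs_le.1 hs
  unfold fold
  rw [ramp_nonpos hd (by linarith), ramp_nonpos hd (by linarith)]; ring

lemma dfold_small {d s : ℝ} (hd : 0 < d) (hs : |s| ≤ 1 - 2 * d) : dfold d s = 0 := by
  have := abs_le.1 hs
  unfold dfold
  rw [dramp_nonpos hd (by linarith), dramp_nonpos hd (by linarith)]; ring

lemma dfold_abs_le {d s : ℝ} (hd : 0 < d) : |dfold d s| ≤ 1 := by
  unfold dfold
  rw [abs_le]
  have h1 := dramp_nonneg (t := s - (1 - 2*d)) hd
  have h2 := dramp_nonneg (t := -s - (1 - 2*d)) hd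
  have h3 := dramp_le_one (t := s - (1 - 2*d)) hd
  have h4 := dramp_le_one (t := -s - (1 - 2*d)) hd
  constructor <;> linarith

lemma fold_mid {d s : ℝ} (hd : 0 < d) (hd' : d < 1/4) (hs0 : 0 ≤ s) (hs : s ≤ 1 - d) :
    s ≤ fold d s ∧ fold d s ≤ 1 - d := by
  rcases le_total s (1 - 2*d) with h | h
  · rw [fold_small hd (by rwa [abs_of_nonneg hs0])]
    constructor <;> linarith
  · rw [fold_pos hd hd' hs0, ramp_mid hd (by linarith) (by linarith)]
    set t := s - (1 - 2*d) with ht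
    have e : s = t + (1 - 2*d) := by rw [ht]; ring
    have : t^2/(2*d) - (t - d/2) = (t-d)^2/(2*d) := by field_simp; ring
    have h1 : 0 ≤ (t-d)^2/(2*d) := by positivity
    have h2 : t^2/(2*d) ≤ d/2 := by
      rw [div_le_iff₀ (by positivity)]; nlinarith
    constructor <;> linarith

lemma V_anti {V : ℝ → ℝ} (hV : Assumption1 V) : AntitoneOn V (Set.Icc 0 1) := by
  have hd : Differentiable ℝ V := hV.smooth.differentiable (by simp)
  have h1 : V 1 = 0 := (hV.zero_iff 1 one_pos).2 rfl
  have key := hasDerivWithinAt_forall_lt_or_forall_gt_of_forall_ne (f := V) (f' := deriv V)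
    (s := Set.Ioo 0 1) (m := 0) (convex_Ioo 0 1)
    (fun x _ => (hd x).hasDerivAt.hasDerivWithinAt)
    (fun x hx h => by
      have := (hV.deriv_zero_iff x hx.1).1 h
      linarith [hx.2])
  rcases key with h | h
  · exact (strictAntiOn_of_deriv_neg (convex_Icc 0 1) hd.continuous.continuousOn
      (by rw [interior_Icc]; exact h)).antitoneOn
  · have := (strictMonoOn_of_deriv_pos (convex_Icc 0 1) hd.continuous.continuousOn
      (by rw [interior_Icc]; exact h)) (a := 1/2) (b := 1) (by norm_num) (by norm_num) (by norm_num)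
    linarith [hV.nonneg (1/2)]

lemma V_quad {V : ℝ → ℝ} (hV : Assumption1 V) :
    ∃ K : ℝ, 0 ≤ K ∧ ∀ s ∈ Set.Icc (0:ℝ) 1, V s ≤ K * (1 - s)^2 := by
  have hd : Differentiable ℝ V := hV.smooth.differentiable (by simp)
  have h1 : V 1 = 0 := (hV.zero_iff 1 one_pos).2 rfl
  have h1' : deriv V 1 = 0 := (hV.deriv_zero_iff 1 one_pos).2 rfl
  have hs1 : ContDiff ℝ 1 (deriv V) := by
    have : ContDiff ℝ (1+1) V := hV.smooth.of_le (by
      rw [one_add_one_eq_two]; exact WithTop.coe_le_coe.2 (le_top : (2:ℕ∞) ≤ ⊤))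
    exact (contDiff_succ_iff_deriv.1 this).2.2
  have hd1 : Differentiable ℝ (deriv V) := hs1.differentiable (by simp)
  have hc : Continuous (deriv (deriv V)) := hs1.continuous_deriv le_rfl
  obtain ⟨K, hK⟩ := (isCompact_Icc (a := (0:ℝ)) (b := 1)).exists_bound_of_continuousOn
    hc.continuousOn
  have hK0 : 0 ≤ K := (norm_nonneg _).trans (hK 0 (by norm_num))
  have hb : ∀ s ∈ Set.Icc (0:ℝ) 1, ‖deriv V s‖ ≤ K * (1 - s) := by
    intro s hs
    have := (convex_Icc (0:ℝ) 1).norm_image_sub_le_of_norm_deriv_le (f := deriv V) (C := K)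
      (fun x _ => hd1 x) hK (x := 1) (y := s) (by norm_num) hs
    rw [h1', sub_zero, Real.norm_eq_abs (s - 1), abs_sub_comm, abs_of_nonneg (by linarith [hs.2])] at this
    exact this
  refine ⟨K, hK0, fun s hs => ?_⟩
  have := (convex_Icc s 1).norm_image_sub_le_of_norm_deriv_le (f := V) (C := K * (1 - s))
      (fun x _ => hd x) (fun x hx => (hb x ⟨hs.1.trans hx.1, hx.2⟩).trans
        (mul_le_mul_of_nonneg_left (by linarith [hx.1]) hK0)) (x := 1) (y := s) 
        ⟨hs.2, le_rfl⟩ ⟨le_rfl, hs.2⟩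
  rw [h1, sub_zero, Real.norm_eq_abs (s - 1), abs_sub_comm, abs_of_nonneg (by linarith [hs.2] : 0 ≤ 1 - s)] at this
  linarith [le_abs_self (V s), Real.norm_eq_abs (V s)]

lemma V_abs {V : ℝ → ℝ} (hV : Assumption1 V) (s : ℝ) : V |s| = V s := by
  rcases abs_choice s with h | h <;> rw [h]
  exact hV.even s

lemma V_fold_le {V : ℝ → ℝ} (hV : Assumption1 V) {d s : ℝ} (hd : 0 < d) (hd' : d < 1/4) :
    V (fold d s) ≤ V s := by
  rw [← fold_abs, ← V_abs hV s]
  rcases le_total |s| (1 - d) with h | h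
  · have := fold_mid hd hd' (abs_nonneg s) h
    exact V_anti hV ⟨abs_nonneg s, by linarith⟩ ⟨(abs_nonneg s).trans this.1, by linarith⟩ this.1
  · rw [fold_large hd hd' h]

/-- gain density -/
noncomputable def gain (V : ℝ → ℝ) (d s : ℝ) : ℝ :=
  Real.sqrt (2 * (V (min |s| (1 - 2*d)) - V (1 - 2*d)))

lemma gain_cont {V : ℝ → ℝ} (hV : Assumption1 V) (d : ℝ) : Continuous (gain V d) := by
  have := hV.smooth.continuous
  unfold gain; fun_prop

lemma gain_pointwise {V : ℝ → ℝ} (hV : Assumption1 V) {d : ℝ} (hd : 0 < d) (hd' : d < 1/4)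
    (s p : ℝ) : (1/2) * (dfold d s * p)^2 + V (fold d s) + gain V d s * |p| ≤ (1/2) * p^2 + V s := by
  rcases le_total |s| (1 - 2*d) with h | h
  · rw [dfold_small hd h, fold_small hd h]
    unfold gain
    rw [min_eq_left h, V_abs hV]
    have hA : V (1 - 2*d) ≤ V s := by
      rw [← V_abs hV s]
      exact V_anti hV ⟨abs_nonneg s, by linarith⟩ ⟨by linarith, by linarith⟩ h
    have hB : V (1 - d - d/2) ≤ V (1 - 2*d) := 
      V_anti hV ⟨by linarith, by linarith⟩ ⟨by linarith, by linarith⟩ (by linarith)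
    have hq := Real.sq_sqrt (show 0 ≤ 2 * (V s - V (1 - 2*d)) by linarith)
    set q := Real.sqrt (2 * (V s - V (1 - 2*d)))
    nlinarith [sq_nonneg (q - |p|), sq_abs p]
  · have h0 : gain V d s = 0 := by unfold gain; rw [min_eq_right h]; simp
    rw [h0]
    have := V_fold_le hV (s := s) hd hd'
    have h2 : (dfold d s)^2 ≤ 1 := by
      have := dfold_abs_le (s := s) hd
      rwa [sq_le_one_iff_abs_le_one]
    have : (dfold d s * p)^2 ≤ p^2 := by rw [mul_pow]; nlinarith [sq_nonneg p]
    linarith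

lemma gain_integral {V : ℝ → ℝ} (hV : Assumption1 V) {d : ℝ} {u : ℝ → ℝ}
    (hu : ContDiff ℝ 1 u) {x y : ℝ} (hxy : x ≤ y) :
    |∫ s in (u x)..(u y), gain V d s| ≤ ∫ t in x..y, gain V d (u t) * |deriv u t| := by
  have hg := gain_cont hV d
  have hdu : Continuous (deriv u) := hu.continuous_deriv le_rfl
  have hch : (∫ t in x..y, gain V d (u t) * deriv u t) = ∫ s in (u x)..(u y), gain V d s :=
    intervalIntegral.integral_comp_mul_deriv (f := u) (f' := deriv u) (g := gain V d)
      (fun t _ => ((hu.differentiable (by simp)) t).hasDerivAt) hdu.continuousOn hg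
  rw [← hch]
  refine (intervalIntegral.abs_integral_le_integral_abs hxy).trans (le_of_eq ?_)
  congr 1
  funext t
  rw [abs_mul, abs_of_nonneg (show 0 ≤ gain V d (u t) from Real.sqrt_nonneg _)]

lemma gain_lower {V : ℝ → ℝ} (hV : Assumption1 V) :
    ∃ C : ℝ, 0 < C ∧ ∀ d : ℝ, 0 < d → d < 1/4 → ∀ p q : ℝ, p ≤ d → 1 - 2*d ≤ q →
      c0 V - C * d ≤ 2 * ∫ s in p..q, gain V d s := by
  obtain ⟨K, hK0, hK⟩ := V_quad hV
  have hVc := hV.smooth.continuous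
  set B := Real.sqrt (2 * V 0) with hB
  have hB0 : 0 ≤ B := Real.sqrt_nonneg _
  set f : ℝ → ℝ := fun s => Real.sqrt (2 * V s) with hf
  have hfc : Continuous f := by rw [hf]; fun_prop
  have hfB : ∀ s ∈ Set.Icc (0:ℝ) 1, f s ≤ B := fun s hs => Real.sqrt_le_sqrt
    (by linarith [V_anti hV (a := 0) (b := s) (by norm_num) hs hs.1])
  have hint : ∀ a b, IntervalIntegrable f volume a b := fun a b => hfc.intervalIntegrable a b
  have hc0 : c0 V = 2 * ∫ s in (0:ℝ)..1, f s := by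
    unfold c0
    rw [← intervalIntegral.integral_add_adjacent_intervals (hint (-1) 0) (hint 0 1)]
    have : (∫ s in (-1:ℝ)..0, f s) = ∫ s in (0:ℝ)..1, f s := by
      have := intervalIntegral.integral_comp_neg (a := 0) (b := 1) f
      rw [neg_zero] at this
      rw [← this]
      congr 1
      funext s
      simp only [hf, hV.even]
    rw [this]; ring
  refine ⟨2 * (3 * B + 2 * Real.sqrt (2 * K)) + 1, by positivity, ?_⟩
  intro d hd hd' p q hp hq
  have hgc := gain_cont hV d
  have hgi : ∀ a b, IntervalIntegrable (gain V d) volume a b := fun a b => hgc.intervalIntegrable a b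
  have e1 : (∫ s in d..(1 - 2*d), gain V d s) ≤ ∫ s in p..q, gain V d s :=
    intervalIntegral.integral_mono_interval hp (by linarith) hq
      (Filter.Eventually.of_forall fun s => Real.sqrt_nonneg _) (hgi _ _)
  set b := 2 * Real.sqrt (2 * K) * d with hb
  have hb0 : 0 ≤ b := by positivity
  have hVb : Real.sqrt (2 * V (1 - 2*d)) ≤ b := by
    apply Real.sqrt_le_iff.2 ⟨hb0, ?_⟩
    have := hK (1 - 2*d) ⟨by linarith, by linarith⟩
    have h2 := Real.sq_sqrt (show 0 ≤ 2 * K by linarith)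
    rw [hb]
    calc 2 * V (1 - 2*d) ≤ 2 * K * 4 * d^2 := by nlinarith
      _ = _ := by rw [mul_pow, mul_pow, h2]; ring
  have e2 : (∫ s in d..(1 - 2*d), (f s - b)) ≤ ∫ s in d..(1 - 2*d), gain V d s := by
    apply intervalIntegral.integral_mono_on (by linarith)
      ((hint _ _).sub intervalIntegrable_const) (hgi _ _)
    intro s hs
    have h1 : |s| = s := abs_of_nonneg (by linarith [hs.1])
    unfold gain
    rw [h1, min_eq_left hs.2]
    have hA : V (1 - 2*d) ≤ V s :=
      V_anti hV ⟨by linarith [hs.1], by linarith [hs.2]⟩ ⟨by linarith, by linarith⟩ hs.2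
    have h3 : f s ≤ Real.sqrt (2 * (V s - V (1 - 2*d))) + Real.sqrt (2 * V (1 - 2*d)) := by
      have h4 := Real.sqrt_nonneg (2 * (V s - V (1 - 2*d)))
      have h5 := Real.sqrt_nonneg (2 * V (1 - 2*d))
      apply Real.sqrt_le_iff.2 ⟨by positivity, ?_⟩
      have h6 := Real.sq_sqrt (show 0 ≤ 2 * (V s - V (1 - 2*d)) by linarith)
      have h7 := Real.sq_sqrt (show 0 ≤ 2 * V (1 - 2*d) by linarith [hV.nonneg (1 - 2*d)])
      nlinarith [mul_nonneg h4 h5]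
    linarith
  rw [intervalIntegral.integral_sub (hint _ _) intervalIntegrable_const,
    intervalIntegral.integral_const] at e2
  have e3 : (∫ s in (0:ℝ)..d, f s) ≤ d * B := by
    have := intervalIntegral.integral_mono_on hd.le (hint 0 d) (intervalIntegrable_const (c := B))
      (fun s hs => hfB s ⟨hs.1, by linarith [hs.2]⟩)
    simpa using this
  have e4 : (∫ s in (1 - 2*d)..1, f s) ≤ 2 * d * B := by
    have := intervalIntegral.integral_mono_on (by linarith) (hint (1 - 2*d) 1)
      (intervalIntegrable_const (c := B))
      (fun s hs => hfB s ⟨by linarith [hs.1], by linarith [hs.2]⟩)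
    simpa using this
  have e5 : (∫ s in (0:ℝ)..1, f s) = (∫ s in (0:ℝ)..d, f s) + (∫ s in d..(1 - 2*d), f s)
      + ∫ s in (1 - 2*d)..1, f s := by
    rw [intervalIntegral.integral_add_adjacent_intervals (hint _ _) (hint _ _),
      intervalIntegral.integral_add_adjacent_intervals (hint _ _) (hint _ _)]
  rw [hc0, e5]
  simp only [smul_eq_mul] at e2
  have : (1 - 2*d - d) * b ≤ b := by nlinarith
  nlinarith

lemma comp_plus {V : ℝ → ℝ} (hV : Assumption1 V) {d : ℝ} (hd : 0 < d) (hd' : d < 1/4)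
    {u : ℝ → ℝ} (hu : ContDiff ℝ 1 u) {a b xm x0 xp : ℝ} (h1 : a ≤ xm) (h2 : xm < x0)
    (h3 : x0 < xp) (h4 : xp ≤ b) (hm : |u xm - 1| ≤ d) (hp : |u xp - 1| ≤ d) :
    ∃ v : ℝ → ℝ, ContDiff ℝ 1 v ∧ v a = u a ∧ v b = u b ∧
      energy V a b v + ((∫ s in (u x0)..(u xm), gain V d s) + ∫ s in (u x0)..(u xp), gain V d s)
        ≤ energy V a b u := by
  have hVc := hV.smooth.continuous
  have hg := gain_cont hV d
  have hm' : 1 - d ≤ u xm := by linarith [(abs_le.1 hm).1]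
  have hp' : 1 - d ≤ u xp := by linarith [(abs_le.1 hp).1]
  have hu' : ∀ x, HasDerivAt u (deriv u x) x := fun x => (hu.differentiable (by simp) x).hasDerivAt
  have hduc : Continuous (deriv u) := hu.continuous_deriv le_rfl
  have hF : ∀ x, HasDerivAt (fun x => fold d (u x)) (dfold d (u x) * deriv u x) x :=
    fun x => (fold_hasDeriv hd (u x)).comp x (hu' x)
  have hFc : Continuous (fun x => dfold d (u x) * deriv u x) :=
    ((dfold_cont d).comp hu.continuous).mul hduc
  set w : ℝ → ℝ := fun x => if x ≤ xp then fold d (u x) else u x with hw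
  set w' : ℝ → ℝ := fun x => if x ≤ xp then dfold d (u x) * deriv u x else deriv u x with hw'
  have hwd : ∀ x, HasDerivAt w (w' x) x := glue_hasDeriv hF hu'
    (fold_large hd hd' hp') (by rw [dfold_large hd hd' hp', one_mul])
  have hwc : Continuous w' := glue_cont hFc hduc (by rw [dfold_large hd hd' hp', one_mul])
  have hmp : xm ≤ xp := by linarith
  set v : ℝ → ℝ := fun x => if x ≤ xm then u x else w x with hv
  set v' : ℝ → ℝ := fun x => if x ≤ xm then deriv u x else w' x with hv'
  have eq' : deriv u xm = w' xm := by
    simp only [hw', if_pos hmp]; rw [dfold_large hd hd' hm', one_mul]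
  have hvd : ∀ x, HasDerivAt v (v' x) x := glue_hasDeriv hu' hwd
    (by simp only [hw, if_pos hmp]; rw [fold_large hd hd' hm']) eq'
  have hvc : Continuous v' := glue_cont hduc hwc eq'
  have hdv : deriv v = v' := funext fun x => (hvd x).deriv
  have hvC : ContDiff ℝ 1 v := contDiff_one_iff_deriv.2
    ⟨fun x => (hvd x).differentiableAt, by rw [hdv]; exact hvc⟩
  refine ⟨v, hvC, by simp [hv, h1], ?_, ?_⟩
  · simp only [hv, if_neg (show ¬ b ≤ xm by linarith), hw]
    rcases eq_or_lt_of_le h4 with e | e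
    · rw [← e]; simp [fold_large hd hd' hp']
    · simp [not_le.2 e]
  set eu : ℝ → ℝ := fun x => (1/2) * (deriv u x)^2 + V (u x) with heu
  set ev : ℝ → ℝ := fun x => (1/2) * (deriv v x)^2 + V (v x) with hev
  have huc := hu.continuous
  have hvcc := hvC.continuous
  have heuc : Continuous eu := by rw [heu]; fun_prop
  have hevc : Continuous ev := by rw [hev, hdv]; fun_prop
  have split : ∀ f : ℝ → ℝ, Continuous f → (∫ x in a..b, f x) = (∫ x in a..xm, f x) +
      (∫ x in xm..x0, f x) + (∫ x in x0..xp, f x) + ∫ x in xp..b, f x := by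
    intro f hf
    have hint : ∀ a b, IntervalIntegrable f volume a b := fun a b => hf.intervalIntegrable a b
    rw [intervalIntegral.integral_add_adjacent_intervals (hint _ _) (hint _ _),
      intervalIntegral.integral_add_adjacent_intervals (hint _ _) (hint _ _),
      intervalIntegral.integral_add_adjacent_intervals (hint _ _) (hint _ _)]
  unfold energy
  rw [split ev hevc, split eu heuc]
  have o1 : (∫ x in a..xm, ev x) = ∫ x in a..xm, eu x := by
    apply intervalIntegral.integral_congr
    intro x hx
    rw [Set.uIcc_of_le h1] at hx
    simp only [hev, heu, hdv]
    simp only [hv, hv', if_pos hx.2]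
  have o2 : (∫ x in xp..b, ev x) = ∫ x in xp..b, eu x := by
    apply intervalIntegral.integral_congr
    intro x hx
    rw [Set.uIcc_of_le h4] at hx
    have hn : ¬ x ≤ xm := by linarith [hx.1]
    simp only [hev, heu, hdv]
    simp only [hv, hv', if_neg hn, hw, hw']
    rcases eq_or_lt_of_le hx.1 with e | e
    · subst e
      simp [fold_large hd hd' hp', dfold_large hd hd' hp']
    · simp [not_le.2 e]
  have pt : ∀ x ∈ Set.Icc xm xp, ev x + gain V d (u x) * |deriv u x| ≤ eu x := by
    intro x hx
    have := gain_pointwise hV hd hd' (u x) (deriv u x)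
    simp only [hev, heu, hdv]
    simp only [hv, hv', hw, hw', if_pos hx.2]
    split_ifs with hxm
    · have hxe : x = xm := le_antisymm hxm hx.1
      subst hxe
      rw [dfold_large hd hd' hm', fold_large hd hd' hm'] at this
      rwa [one_mul] at this
    · exact this
  have gc : Continuous (fun x => gain V d (u x) * |deriv u x|) := by fun_prop
  have piece : ∀ x y, x ≤ y → xm ≤ x → y ≤ xp →
      (∫ t in x..y, ev t) + |∫ s in (u x)..(u y), gain V d s| ≤ ∫ t in x..y, eu t := by
    intro x y hxy hx hy
    have g1 := gain_integral hV (d := d) hu hxy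
    have g2 := intervalIntegral.integral_mono_on (μ := volume) hxy ((hevc.add gc).intervalIntegrable x y)
      (heuc.intervalIntegrable x y)
      (fun t ht => pt t ⟨hx.trans ht.1, ht.2.trans hy⟩)
    have g3 := intervalIntegral.integral_add (μ := volume) (hevc.intervalIntegrable x y)
      (gc.intervalIntegrable x y)
    simp only [Pi.add_apply] at g2
    linarith
  have p1 := piece xm x0 h2.le le_rfl h3.le
  have p2 := piece x0 xp h3.le h2.le le_rfl
  rw [intervalIntegral.integral_symm (u x0) (u xm), abs_neg] at p1
  have q1 := le_abs_self (∫ s in (u x0)..(u xm), gain V d s)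
  have q2 := le_abs_self (∫ s in (u x0)..(u xp), gain V d s)
  linarith

lemma energy_neg {V : ℝ → ℝ} (hV : Assumption1 V) (a b : ℝ) (u : ℝ → ℝ) :
    energy V a b (fun x => - u x) = energy V a b u := by
  unfold energy
  congr 1
  funext x
  rw [hV.even, deriv.fun_neg, neg_sq]

lemma energy_nonneg {V : ℝ → ℝ} (hV : Assumption1 V) {a b : ℝ} (hab : a ≤ b) (u : ℝ → ℝ) :
    0 ≤ energy V a b u :=
  intervalIntegral.integral_nonneg hab fun x _ => by
    have := hV.nonneg (u x)
    positivity

lemma competitor {V : ℝ → ℝ} (hV : Assumption1 V) :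
    ∃ C : ℝ, 0 < C ∧ ∀ d : ℝ, 0 < d → ∀ a b ℓ : ℝ, a ≤ -ℓ → ℓ ≤ b → ∀ u : ℝ → ℝ,
      ContDiff ℝ 1 u → HasWastedMinusExcursion d ℓ u →
      ∃ v : ℝ → ℝ, ContDiff ℝ 1 v ∧ v a = u a ∧ v b = u b ∧
        energy V a b v + (c0 V - C * d) ≤ energy V a b u := by
  obtain ⟨C, hC, hG⟩ := gain_lower hV
  have hc : 0 ≤ c0 V := intervalIntegral.integral_nonneg (by norm_num)
    fun x _ => Real.sqrt_nonneg _
  refine ⟨C + 4 * c0 V, by positivity, ?_⟩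
  intro d hd a b ℓ ha hb u hu hw
  rcases le_or_gt (1/4) d with h4 | h4
  · exact ⟨u, hu, rfl, rfl, by nlinarith⟩
  have main : ∀ u : ℝ → ℝ, ContDiff ℝ 1 u → ∀ xm x0 xp : ℝ, -ℓ ≤ xm → xm < x0 → x0 < xp →
      xp ≤ ℓ → |u x0| ≤ d → |u xm - 1| ≤ d → |u xp - 1| ≤ d → 
      ∃ v : ℝ → ℝ, ContDiff ℝ 1 v ∧ v a = u a ∧ v b = u b ∧
        energy V a b v + (c0 V - (C + 4 * c0 V) * d) ≤ energy V a b u := by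
    intro u hu xm x0 xp k1 k2 k3 k4 k5 k6 k7
    obtain ⟨v, v1, v2, v3, v4⟩ := comp_plus hV hd h4 hu (ha.trans k1) k2 k3 (k4.trans hb) k6 k7
    refine ⟨v, v1, v2, v3, ?_⟩
    have m1 := hG d hd h4 (u x0) (u xm) (abs_le.1 k5).2 (by linarith [(abs_le.1 k6).1])
    have m2 := hG d hd h4 (u x0) (u xp) (abs_le.1 k5).2 (by linarith [(abs_le.1 k7).1])
    nlinarith [mul_nonneg hc hd.le]
  obtain ⟨xm, x0, xp, k1, k2, k3, k4, k5, ⟨k6, k7⟩ | ⟨k6, k7⟩⟩ := hw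
  · exact main u hu xm x0 xp k1 k2 k3 k4 k5 k6 k7
  · have neg : ∀ x, |(-u x) - 1| = |u x + 1| := fun x => by
      rw [← abs_neg]; congr 1; ring
    obtain ⟨v, v1, v2, v3, v4⟩ := main (fun x => -u x) hu.neg xm x0 xp k1 k2 k3 k4
      (by rwa [abs_neg]) (by rwa [neg]) (by rwa [neg])
    refine ⟨fun x => -v x, v1.neg, by simp [v2], by simp [v3], ?_⟩
    rw [energy_neg hV]
    rwa [energy_neg hV] at v4

lemma exists_wasted {δ ℓ : ℝ} (hδ : 0 < δ) (hℓ : 0 < ℓ) (um up : ℝ) :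
    ∃ u : ℝ → ℝ, ContDiff ℝ 1 u ∧ u (-(2*ℓ)) = um ∧ u (2*ℓ) = up ∧
      HasWastedMinusExcursion δ ℓ u := by
  -- x = ℓ t; even part p(t) = t^2 + α t^2 (t^2-1), odd part β t (t^2-1)
  set α := ((um + up)/2 - 4)/12 with hα
  set β := ((up - um)/2)/6 with hβ
  refine ⟨fun x => (x/ℓ)^2 + α * (x/ℓ)^2 * ((x/ℓ)^2 - 1) + β * (x/ℓ) * ((x/ℓ)^2 - 1),
    by fun_prop, ?_, ?_, -ℓ, 0, ℓ, le_rfl, by linarith, hℓ, le_rfl, ?_, Or.inl ⟨?_, ?_⟩⟩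
  · have : -(2*ℓ)/ℓ = -2 := by field_simp
    simp only [this, hα, hβ]; ring
  · have : (2*ℓ)/ℓ = 2 := by field_simp
    simp only [this, hα, hβ]; ring
  · simp [hδ.le]
  · have : (-ℓ)/ℓ = -1 := by field_simp
    simp [this, hδ.le]
  · have : ℓ/ℓ = 1 := by field_simp
    simp [this, hδ.le]

/-- Cost of a wasted `δ⁻` excursion (Lemma 2.5): performing a wasted `δ⁻` excursion on
`(−ℓ, ℓ)` raises the minimal energy on `(−2ℓ, 2ℓ)` by at least `c₀ − Cδ`, uniformly over
boundary values in `[−M, M]`. -/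
theorem wasted_minus_excursion_cost
    (V : ℝ → ℝ) (hV : Assumption1 V) :
    ∃ C : ℝ, 0 < C ∧
      ∀ M : ℝ, ∀ δ : ℝ, δ ∈ Set.Ioo (0:ℝ) (1/2) →
        ∃ lstar : ℝ, ∀ ℓ : ℝ, lstar ≤ ℓ →
          ∀ um up : ℝ, um ∈ Set.Icc (-M) M → up ∈ Set.Icc (-M) M →
            c0 V - C * δ ≤
              sInf {e : ℝ | ∃ u : ℝ → ℝ, ContDiff ℝ 1 u ∧
                  u (-(2*ℓ)) = um ∧ u (2*ℓ) = up ∧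
                  HasWastedMinusExcursion δ ℓ u ∧
                  e = energy V (-(2*ℓ)) (2*ℓ) u} -
              sInf {e : ℝ | ∃ u : ℝ → ℝ, ContDiff ℝ 1 u ∧
                  u (-(2*ℓ)) = um ∧ u (2*ℓ) = up ∧
                  e = energy V (-(2*ℓ)) (2*ℓ) u} := by
  obtain ⟨C, hC, h⟩ := competitor hV
  refine ⟨C, hC, fun M δ hδ => ⟨1, fun ℓ hℓ um up _ _ => ?_⟩⟩
  rw [le_sub_iff_add_le]
  apply le_csInf
  · obtain ⟨u, u1, u2, u3, u4⟩ := exists_wasted hδ.1 (by linarith : 0 < ℓ) um up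
    exact ⟨_, u, u1, u2, u3, u4, rfl⟩
  · rintro e ⟨u, u1, u2, u3, u4, rfl⟩
    obtain ⟨v, v1, v2, v3, v4⟩ := h δ hδ.1 (-(2*ℓ)) (2*ℓ) ℓ (by linarith) (by linarith) u u1 u4
    have : sInf {e : ℝ | ∃ u : ℝ → ℝ, ContDiff ℝ 1 u ∧
                  u (-(2*ℓ)) = um ∧ u (2*ℓ) = up ∧
                  e = energy V (-(2*ℓ)) (2*ℓ) u} ≤ energy V (-(2*ℓ)) (2*ℓ) v := by
      apply csInf_le
      · refine ⟨0, ?_⟩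
        rintro e ⟨w, _, _, _, rfl⟩
        exact energy_nonneg hV (by linarith) w
      · exact ⟨v, v1, v2.trans u2, v3.trans u3, rfl⟩
    linarith
end

section
/- Upper bound for the minimal energy with prescribed boundary values (construction, eq. (23up)): Assume V satisfies Assumption 1. For every M < ∞ and every γ > 0 there exists ℓ* < ∞ such that for every ℓ ≥ ℓ* and all u₋, u₊ ∈ [−M, M], the infimum of E_{(−2ℓ,2ℓ)}(u) over all continuously differentiable u : ℝ → ℝ with u(−2ℓ) = u₋ and u(2ℓ) = u₊ is at most min(φ₋₁(u₋), φ₊₁(u₋)) + min(φ₋₁(u₊), φ₊₁(u₊)) + c₀ + γ. -/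
open MeasureTheory

/-- `φ₋₁(v) = |∫_{-1}^{v} √(2 V(s)) ds|`. -/
noncomputable def phiMinus (V : ℝ → ℝ) (v : ℝ) : ℝ :=
  |∫ s in (-1:ℝ)..v, Real.sqrt (2 * V s)|

/-- `φ₊₁(v) = |∫_{v}^{1} √(2 V(s)) ds|`. -/
noncomputable def phiPlus (V : ℝ → ℝ) (v : ℝ) : ℝ :=
  |∫ s in v..(1:ℝ), Real.sqrt (2 * V s)|

lemma inv_path (R : ℝ → ℝ) (hR : Continuous R) (r B : ℝ) (hr : 0 < r) (h1 : ∀ s, r ≤ R s)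
    (h2 : ∀ s, R s ≤ B) (a b : ℝ) (hab : a ≤ b) :
    ∃ (w : ℝ → ℝ) (L : ℝ), 0 ≤ L ∧ L ≤ (b - a) / r ∧ w 0 = a ∧ w L = b ∧
      ∀ x, HasDerivAt w (R (w x)) x := by
  have hpos : ∀ s, 0 < R s := fun s => lt_of_lt_of_le hr (h1 s)
  have hB : 0 < B := lt_of_lt_of_le (hpos 0) (h2 0)
  have hc : Continuous (fun s => (R s)⁻¹) := hR.inv₀ (fun s => (hpos s).ne')
  set G : ℝ → ℝ := fun v => ∫ s in a..v, (R s)⁻¹ with hG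
  have hd : ∀ v, HasDerivAt G (R v)⁻¹ v := fun v =>
    intervalIntegral.integral_hasDerivAt_right (hc.intervalIntegrable _ _)
      (hc.stronglyMeasurableAtFilter _ _) hc.continuousAt
  have hGc : Continuous G := continuous_iff_continuousAt.2 fun v => (hd v).continuousAt
  have hmono : StrictMono G := strictMono_of_deriv_pos fun v => by
    rw [(hd v).deriv]; exact inv_pos.2 (hpos v)
  have hGa : G a = 0 := by simp [hG]
  have hm2 : Monotone (fun v => G v - v / B) := by
    refine monotone_of_deriv_nonneg (fun v => ((hd v).sub ((hasDerivAt_id v).div_const B)).differentiableAt) fun v => ?_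
    have := ((hd v).sub ((hasDerivAt_id v).div_const B)).deriv
    have e : deriv (fun v => G v - v / B) v = (R v)⁻¹ - 1 / B := this
    rw [e, one_div, sub_nonneg]
    exact inv_anti₀ (hpos v) (h2 v)
  have hsurj : Function.Surjective G := by
    refine hGc.surjective ?_ ?_
    · refine Filter.tendsto_atTop_mono' _ (f₁ := fun v => (v - a) / B) ?_ ?_
      · filter_upwards [Filter.eventually_ge_atTop a] with v hv
        have := hm2 hv
        simp only [hGa] at this
        rw [sub_div]; linarith
      · exact (Filter.tendsto_atTop_add_const_right _ (-a) Filter.tendsto_id).atTop_div_const hB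
    · refine Filter.tendsto_atBot_mono' _ (f₁ := fun v => (v - a) / B) ?_ ?_
      · filter_upwards [Filter.eventually_le_atBot a] with v hv
        have := hm2 hv
        simp only [hGa] at this
        rw [sub_div]; linarith
      · exact (Filter.tendsto_atBot_add_const_right _ (-a) Filter.tendsto_id).atBot_div_const hB
  let e := hmono.orderIsoOfSurjective G hsurj
  have he : ∀ v, e.symm (G v) = v := fun v => e.symm_apply_apply v
  have he' : ∀ x, G (e.symm x) = x := fun x => e.apply_symm_apply x
  refine ⟨e.symm, G b, ?_, ?_, ?_, he b, ?_⟩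
  · rw [← hGa]; exact hmono.monotone hab
  · have : G b ≤ ∫ s in a..b, r⁻¹ :=
      intervalIntegral.integral_mono_on hab (hc.intervalIntegrable _ _)
        (continuous_const.intervalIntegrable _ _) fun s _ => inv_anti₀ hr (h1 s)
    simpa [div_eq_mul_inv] using this
  · rw [← hGa]; exact he a
  · intro x
    have := HasDerivAt.of_local_left_inverse (f := G) (g := e.symm) (a := x)
      e.symm.continuous.continuousAt (hd (e.symm x)) (inv_pos.2 (hpos _)).ne'
      (Filter.Eventually.of_forall he')
    simpa using this

lemma ramp_exists (η : ℝ) (hη : 0 < η) (L : ℝ) (hL : 0 ≤ L) :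
    ∃ (θ θ' : ℝ → ℝ), (∀ x, HasDerivAt θ (θ' x) x) ∧ Continuous θ' ∧
      (∀ x, 0 ≤ θ' x ∧ θ' x ≤ 1) ∧ (∀ x ≤ 0, θ x = 0) ∧ (∀ x, L + η ≤ x → θ x = L) := by
  set k : ℝ → ℝ := fun y => max 0 (min 1 (y / η)) with hk
  have kc : Continuous k := by fun_prop
  have kmono : Monotone k := fun x y h => by simp only [hk]; gcongr
  have k0 : ∀ x, 0 ≤ k x := fun x => le_max_left _ _
  have k1 : ∀ x, k x ≤ 1 := fun x => max_le (by norm_num) (min_le_left _ _)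
  have kneg : ∀ x ≤ 0, k x = 0 := fun x hx =>
    max_eq_left ((min_le_right _ _).trans (div_nonpos_of_nonpos_of_nonneg hx hη.le))
  have kbig : ∀ x, η ≤ x → k x = 1 := fun x hx => by
    have : 1 ≤ x / η := by rwa [le_div_iff₀ hη, one_mul]
    simp [hk, min_eq_left this]
  set ρ : ℝ → ℝ := fun x => ∫ y in (0:ℝ)..x, k y with hρ
  have hd : ∀ v, HasDerivAt ρ (k v) v := fun v =>
    intervalIntegral.integral_hasDerivAt_right (kc.intervalIntegrable _ _)
      (kc.stronglyMeasurableAtFilter _ _) kc.continuousAt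
  have ρneg : ∀ x ≤ 0, ρ x = 0 := fun x hx => by
    simp only [hρ]
    rw [intervalIntegral.integral_symm, neg_eq_zero]
    rw [intervalIntegral.integral_congr (g := fun _ => (0:ℝ))]
    · simp
    · intro y hy
      rw [Set.uIcc_of_le hx] at hy
      exact kneg y hy.2
  refine ⟨fun x => ρ x - ρ (x - L), fun x => k x - k (x - L), ?_, by fun_prop, ?_, ?_, ?_⟩
  · intro x
    exact (hd x).sub ((hd (x - L)).comp_sub_const x L)
  · intro x
    have := kmono (show x - L ≤ x by linarith)
    exact ⟨by linarith, by linarith [k1 x, k0 (x - L)]⟩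
  · intro x hx
    simp [ρneg x hx, ρneg (x - L) (by linarith)]
  · intro x hx
    simp only [hρ]
    rw [intervalIntegral.integral_interval_sub_left (kc.intervalIntegrable _ _) (kc.intervalIntegrable _ _)]
    rw [intervalIntegral.integral_congr (g := fun _ => (1:ℝ))]
    · simp
    · intro y hy
      rw [Set.uIcc_of_le (by linarith)] at hy
      exact kbig y (by linarith [hy.1])

/-- Existence of a path from `a` to `b` in time `T` with energy at most `E`. -/
def HasPath (V : ℝ → ℝ) (T a b E : ℝ) : Prop :=
  0 ≤ T ∧ ∃ u : ℝ → ℝ, ContDiff ℝ 1 u ∧ (∀ x ≤ 0, u x = a) ∧ (∀ x, T ≤ x → u x = b) ∧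
    energy V 0 T u ≤ E

lemma energy_cont (V : ℝ → ℝ) (hV : Continuous V) (u : ℝ → ℝ) (hu : ContDiff ℝ 1 u) :
    Continuous (fun x => (1/2) * (deriv u x)^2 + V (u x)) := by
  have := hu.continuous_deriv (le_refl _)
  have := hu.continuous
  fun_prop

lemma energy_congr (V : ℝ → ℝ) (u v : ℝ → ℝ) (a b : ℝ) (hab : a ≤ b)
    (h : ∀ x ∈ Set.Ioo a b, u x = v x) : energy V a b u = energy V a b v := by
  unfold energy
  rw [intervalIntegral.integral_of_le hab, intervalIntegral.integral_of_le hab,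
    integral_Ioc_eq_integral_Ioo, integral_Ioc_eq_integral_Ioo]
  refine setIntegral_congr_fun measurableSet_Ioo fun x hx => ?_
  have : u =ᶠ[nhds x] v := by
    filter_upwards [isOpen_Ioo.mem_nhds hx] with y hy using h y hy
  simp only [this.deriv_eq, h x hx]

lemma energy_shift (V : ℝ → ℝ) (u : ℝ → ℝ) (a b c : ℝ) :
    energy V a b (fun x => u (x + c)) = energy V (a + c) (b + c) u := by
  unfold energy
  rw [← intervalIntegral.integral_comp_add_right (fun x => (1/2) * (deriv u x)^2 + V (u x))]
  congr 1
  ext x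
  rw [deriv_comp_add_const]

lemma HasPath.trans {V : ℝ → ℝ} (hV : Continuous V) {T S a b c E F : ℝ}
    (h1 : HasPath V T a b E) (h2 : HasPath V S b c F) : HasPath V (T + S) a c (E + F) := by
  obtain ⟨hT, u, hu, u0, u1, hE⟩ := h1
  obtain ⟨hS, v, hv, v0, v1, hF⟩ := h2
  have hw : ContDiff ℝ 1 (fun x => u x + v (x + -T) - b) :=
    (hu.add (hv.comp (contDiff_id.add contDiff_const))).sub contDiff_const
  refine ⟨by linarith, fun x => u x + v (x + -T) - b, hw, ?_, ?_, ?_⟩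
  · intro x hx
    simp [u0 x hx, v0 (x + -T) (by linarith)]
  · intro x hx
    simp [u1 x (by linarith), v1 (x + -T) (by linarith)]
  · have hi := energy_cont V hV _ hw
    have : energy V 0 (T + S) (fun x => u x + v (x + -T) - b) =
        energy V 0 T (fun x => u x + v (x + -T) - b) +
        energy V T (T + S) (fun x => u x + v (x + -T) - b) :=
      (intervalIntegral.integral_add_adjacent_intervals (hi.intervalIntegrable _ _)
        (hi.intervalIntegrable _ _)).symm
    rw [this, energy_congr V _ u 0 T hT, energy_congr V _ (fun x => v (x + -T)) T (T+S) (by linarith),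
      energy_shift]
    · simp only [add_neg_cancel, add_neg_cancel_comm]
      linarith
    · intro x hx
      simp [u1 x hx.1.le]
    · intro x hx
      simp [v0 (x + -T) (by linarith [hx.2])]

lemma HasPath.mono {V : ℝ → ℝ} {T a b E F : ℝ}
    (h1 : HasPath V T a b E) (h : E ≤ F) : HasPath V T a b F := by
  obtain ⟨hT, u, hu, u0, u1, hE⟩ := h1
  exact ⟨hT, u, hu, u0, u1, hE.trans h⟩

lemma HasPath.neg {V : ℝ → ℝ} (hV : ∀ u, V (-u) = V u) {T a b E : ℝ}
    (h1 : HasPath V T a b E) : HasPath V T (-a) (-b) E := by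
  obtain ⟨hT, u, hu, u0, u1, hE⟩ := h1
  refine ⟨hT, fun x => - u x, hu.neg, fun x hx => by simp [u0 x hx], fun x hx => by simp [u1 x hx], ?_⟩
  have : energy V 0 T (fun x => - u x) = energy V 0 T u := by
    unfold energy
    congr 1
    ext x
    rw [deriv.fun_neg, hV]; ring
  rwa [this]

lemma hasPath_const {V : ℝ → ℝ} {T a : ℝ} (hT : 0 ≤ T) (ha : V a = 0) : HasPath V T a a 0 := by
  refine ⟨hT, fun _ => a, contDiff_const, fun _ _ => rfl, fun _ _ => rfl, ?_⟩
  simp [energy, ha]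

lemma move_le (V : ℝ → ℝ) (hV : Continuous V) (hn : ∀ u, 0 ≤ V u) (K ε : ℝ) (hK : 0 < K)
    (hε : 0 < ε) : ∃ Ts : ℝ, ∀ a b : ℝ, -K ≤ a → a ≤ b → b ≤ K →
      ∃ T ≤ Ts, HasPath V T a b ((∫ s in a..b, Real.sqrt (2 * V s)) + ε) := by
  obtain ⟨B0, hB0⟩ := (isCompact_Icc (a := -K) (b := K)).exists_bound_of_continuousOn hV.continuousOn
  have hB : ∀ s ∈ Set.Icc (-K) K, V s ≤ B0 := fun s hs => (le_abs_self _).trans (hB0 s hs)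
  have hB00 : 0 ≤ B0 := (hn 0).trans (hB 0 ⟨by linarith, hK.le⟩)
  set r := ε / (4 * K) with hr
  have hr0 : 0 < r := by positivity
  set W : ℝ → ℝ := fun s => V (max (-K) (min K s)) + r^2 / 2 with hW
  have hWc : Continuous W := by fun_prop
  have hcl : ∀ s, max (-K) (min K s) ∈ Set.Icc (-K) K := fun s =>
    ⟨le_max_left _ _, max_le (by linarith) (min_le_left _ _)⟩
  have hWi : ∀ s ∈ Set.Icc (-K) K, W s = V s + r^2/2 := fun s hs => by
    simp only [hW]; rw [min_eq_right hs.2, max_eq_right hs.1]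
  have hWl : ∀ s, r^2/2 ≤ W s := fun s => by simp only [hW]; linarith [hn (max (-K) (min K s))]
  set B := B0 + r^2/2 with hBd
  have hBpos : 0 < B := by positivity
  have hWu : ∀ s, W s ≤ B := fun s => by simp only [hW]; linarith [hB _ (hcl s)]
  have hW0 : ∀ s, 0 ≤ W s := fun s => le_trans (by positivity) (hWl s)
  set R : ℝ → ℝ := fun s => Real.sqrt (2 * W s) with hR
  have hRc : Continuous R := by fun_prop
  have hR2 : ∀ s, R s ^ 2 = 2 * W s := fun s => Real.sq_sqrt (by linarith [hW0 s])
  have hRl : ∀ s, r ≤ R s := fun s => Real.le_sqrt_of_sq_le (by linarith [hWl s])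
  have hRu : ∀ s, R s ≤ Real.sqrt (2 * B) := fun s => Real.sqrt_le_sqrt (by linarith [hWu s])
  set η := ε / (2 * B) with hη
  have hη0 : 0 < η := by positivity
  refine ⟨2 * K / r + η, fun a b ha hab hb => ?_⟩
  obtain ⟨w, L, hL0, hL, w0, wL, hw⟩ := inv_path R hRc r _ hr0 hRl hRu a b hab
  obtain ⟨θ, θ', hθ, hθc, hθ1, hθ0, hθL⟩ := ramp_exists η hη0 L hL0
  have hwc : Continuous w := continuous_iff_continuousAt.2 fun x => (hw x).continuousAt
  have hθcc : Continuous θ := continuous_iff_continuousAt.2 fun x => (hθ x).continuousAt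
  have hwm : Monotone w := monotone_of_deriv_nonneg (fun x => (hw x).differentiableAt) fun x => by
    rw [(hw x).deriv]; exact Real.sqrt_nonneg _
  have hθm : Monotone θ := monotone_of_deriv_nonneg (fun x => (hθ x).differentiableAt) fun x => by
    rw [(hθ x).deriv]; exact (hθ1 x).1
  have hu : ∀ x, HasDerivAt (fun x => w (θ x)) (R (w (θ x)) * θ' x) x := fun x =>
    (hw (θ x)).comp x (hθ x)
  have hud : deriv (fun x => w (θ x)) = fun x => R (w (θ x)) * θ' x := funext fun x => (hu x).deriv
  have hdc : Continuous (fun x => R (w (θ x)) * θ' x) := by fun_prop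
  have hT0 : 0 ≤ L + η := by linarith
  refine ⟨L + η, ?_, hT0, fun x => w (θ x), ?_, ?_, ?_, ?_⟩
  · have : (b - a) / r ≤ 2 * K / r := by gcongr; linarith
    linarith
  · rw [contDiff_one_iff_deriv]
    refine ⟨fun x => (hu x).differentiableAt, ?_⟩
    rw [hud]; exact hdc
  · intro x hx
    simp only [hθ0 x hx, w0]
  · intro x hx
    simp only [hθL x hx, wL]
  · have hsub : ∫ x in (0:ℝ)..(L + η), R (w (θ x)) * (R (w (θ x)) * θ' x) = ∫ s in a..b, R s := by
      have := intervalIntegral.integral_comp_mul_deriv (a := 0) (b := L + η)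
        (f := fun x => w (θ x)) (f' := fun x => R (w (θ x)) * θ' x) (g := R)
        (fun x _ => hu x) hdc.continuousOn hRc
      rw [hθ0 0 le_rfl, hθL (L+η) le_rfl, w0, wL] at this
      exact this
    have hth : ∫ x in (0:ℝ)..(L + η), θ' x = L := by
      rw [intervalIntegral.integral_eq_sub_of_hasDerivAt (fun x _ => hθ x) (hθc.intervalIntegrable _ _),
        hθ0 0 le_rfl, hθL (L+η) le_rfl, sub_zero]
    have h1 : energy V 0 (L + η) (fun x => w (θ x)) ≤
        ∫ x in (0:ℝ)..(L + η), (R (w (θ x)) * (R (w (θ x)) * θ' x) + (B - B * θ' x)) := by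
      unfold energy
      rw [hud]
      refine intervalIntegral.integral_mono_on hT0 (Continuous.intervalIntegrable (by fun_prop) _ _)
        (Continuous.intervalIntegrable (by fun_prop) _ _) fun x hx => ?_
      beta_reduce
      have hm : w (θ x) ∈ Set.Icc (-K) K := by
        have e1 := hwm (hθm hx.1)
        have e2 := hwm (hθm hx.2)
        rw [hθ0 0 le_rfl, w0] at e1
        rw [hθL (L+η) le_rfl, wL] at e2
        exact ⟨by linarith, by linarith⟩
      have e1 := hWi _ hm
      have e2 := hR2 (w (θ x))
      have e3 := hWu (w (θ x))
      have e4 := hW0 (w (θ x))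
      obtain ⟨t0, t1⟩ := hθ1 x
      have e5 : V (w (θ x)) ≤ W (w (θ x)) := by rw [e1]; nlinarith
      generalize W (w (θ x)) = X at *
      generalize R (w (θ x)) = Y at *
      generalize θ' x = t at *
      have e6 : (1/2) * (Y * t)^2 = X * t^2 := by rw [mul_pow, e2]; ring
      have e7 : Y * (Y * t) = 2 * X * t := by rw [← e2]; ring
      rw [e6, e7]
      have e8 : X * (1 - t) ^ 2 ≤ X * (1 - t) := by
        apply mul_le_mul_of_nonneg_left _ e4; nlinarith
      have e9 : X * (1 - t) ≤ B * (1 - t) := mul_le_mul_of_nonneg_right e3 (by linarith)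
      nlinarith
    have h2 : ∫ s in a..b, R s ≤ ∫ s in a..b, (Real.sqrt (2 * V s) + r) := by
      refine intervalIntegral.integral_mono_on hab (hRc.intervalIntegrable _ _)
        (Continuous.intervalIntegrable (by fun_prop) _ _) fun s hs => ?_
      have e1 := hWi s ⟨by linarith [hs.1], by linarith [hs.2]⟩
      have e2 := Real.sq_sqrt (show 0 ≤ 2 * V s by linarith [hn s])
      have e3 := Real.sqrt_nonneg (2 * V s)
      refine Real.sqrt_le_iff.2 ⟨by positivity, ?_⟩
      rw [e1]
      nlinarith
    rw [intervalIntegral.integral_add (Continuous.intervalIntegrable (by fun_prop) _ _)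
      (Continuous.intervalIntegrable (by fun_prop) _ _), intervalIntegral.integral_const,
      smul_eq_mul] at h2
    rw [intervalIntegral.integral_add (Continuous.intervalIntegrable (by fun_prop) _ _)
      (Continuous.intervalIntegrable (by fun_prop) _ _), hsub,
      intervalIntegral.integral_sub (Continuous.intervalIntegrable (by fun_prop) _ _)
      (Continuous.intervalIntegrable (by fun_prop) _ _), intervalIntegral.integral_const_mul, hth,
      intervalIntegral.integral_const, smul_eq_mul] at h1
    have h3 : B * η = ε / 2 := by rw [hη]; field_simp
    have h4 : (b - a) * r ≤ 2 * K * r := mul_le_mul_of_nonneg_right (by linarith) hr0.le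
    have h5 : 2 * K * r = ε / 2 := by rw [hr]; field_simp; norm_num
    nlinarith

lemma move_any (V : ℝ → ℝ) (hV : Assumption1 V) (K ε : ℝ) (hK : 0 < K)
    (hε : 0 < ε) : ∃ Ts : ℝ, ∀ a b : ℝ, a ∈ Set.Icc (-K) K → b ∈ Set.Icc (-K) K →
      ∃ T ≤ Ts, HasPath V T a b (|∫ s in a..b, Real.sqrt (2 * V s)| + ε) := by
  obtain ⟨Ts, h⟩ := move_le V hV.smooth.continuous hV.nonneg K ε hK hε
  refine ⟨Ts, fun a b ha hb => ?_⟩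
  rcases le_total a b with hab | hab
  · obtain ⟨T, hT, hp⟩ := h a b ha.1 hab hb.2
    exact ⟨T, hT, hp.mono (by gcongr; exact le_abs_self _)⟩
  · obtain ⟨T, hT, hp⟩ := h (-a) (-b) (by linarith [ha.2]) (by linarith) (by linarith [hb.1])
    refine ⟨T, hT, ?_⟩
    have := hp.neg hV.even
    rw [neg_neg, neg_neg] at this
    refine this.mono ?_
    have e : ∫ s in (-a)..(-b), Real.sqrt (2 * V s) = ∫ s in b..a, Real.sqrt (2 * V s) := by
      rw [← intervalIntegral.integral_comp_neg]
      simp only [hV.even]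
    rw [e, intervalIntegral.integral_symm]
    gcongr
    exact neg_le_abs _

/-- Upper bound for the minimal energy with prescribed boundary values (eq. (23up)):
the minimal energy on `(−2ℓ, 2ℓ)` with boundary values `u₋, u₊ ∈ [−M, M]` is at most
`min(φ₋₁(u₋), φ₊₁(u₋)) + min(φ₋₁(u₊), φ₊₁(u₊)) + c₀ + γ` once `ℓ` is large enough. -/
theorem minimal_energy_construction_upper_bound
    (V : ℝ → ℝ) (hV : Assumption1 V) (M : ℝ) (γ : ℝ) (hγ : 0 < γ) :
    ∃ lstar : ℝ, ∀ ℓ : ℝ, lstar ≤ ℓ →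
      ∀ um up : ℝ, um ∈ Set.Icc (-M) M → up ∈ Set.Icc (-M) M →
        sInf {e : ℝ | ∃ u : ℝ → ℝ, ContDiff ℝ 1 u ∧
            u (-(2*ℓ)) = um ∧ u (2*ℓ) = up ∧
            e = energy V (-(2*ℓ)) (2*ℓ) u} ≤
          min (phiMinus V um) (phiPlus V um) + min (phiMinus V up) (phiPlus V up) +
            c0 V + γ := by
  set K := max M 1 with hK
  have hK1 : 1 ≤ K := le_max_right _ _
  have hKM : M ≤ K := le_max_left _ _
  obtain ⟨Ts, h⟩ := move_any V hV K (γ / 3) (by linarith) (by linarith)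
  have V1 : V 1 = 0 := (hV.zero_iff 1 one_pos).2 rfl
  have Vm1 : V (-1) = 0 := by rw [hV.even, V1]
  have hc0 : 0 ≤ c0 V := intervalIntegral.integral_nonneg (by norm_num) fun s _ => Real.sqrt_nonneg _
  have hend : ∀ v : ℝ, ∃ σ : ℝ, (σ = 1 ∨ σ = -1) ∧
      |∫ s in v..σ, Real.sqrt (2 * V s)| = min (phiMinus V v) (phiPlus V v) := by
    intro v
    rcases le_total (phiMinus V v) (phiPlus V v) with h | h
    · refine ⟨-1, Or.inr rfl, ?_⟩
      rw [min_eq_left h, phiMinus, intervalIntegral.integral_symm, abs_neg]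
    · exact ⟨1, Or.inl rfl, by rw [min_eq_right h, phiPlus]⟩
  refine ⟨max 0 Ts, fun ℓ hℓ um up hum hup => ?_⟩
  have hℓ0 : 0 ≤ ℓ := (le_max_left _ _).trans hℓ
  have hℓT : Ts ≤ ℓ := (le_max_right _ _).trans hℓ
  obtain ⟨σ, hσ, eσ⟩ := hend um
  obtain ⟨τ, hτ, eτ⟩ := hend up
  have hmem : ∀ σ : ℝ, (σ = 1 ∨ σ = -1) → σ ∈ Set.Icc (-K) K := by
    rintro σ (rfl | rfl) <;> constructor <;> linarith
  have hVσ : V σ = 0 := by rcases hσ with rfl | rfl <;> assumption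
  obtain ⟨T1, hT1, p1⟩ := h um σ ⟨by linarith [hum.1], by linarith [hum.2]⟩ (hmem σ hσ)
  obtain ⟨T2, hT2, p2⟩ := h σ τ (hmem σ hσ) (hmem τ hτ)
  obtain ⟨T3, hT3, p3⟩ := h τ up (hmem τ hτ) ⟨by linarith [hup.1], by linarith [hup.2]⟩
  have p4 : HasPath V (4 * ℓ - T1 - T2 - T3) σ σ 0 := hasPath_const (by linarith) hVσ
  have hc := hV.smooth.continuous
  have p := ((p1.trans hc p4).trans hc p2).trans hc p3
  rw [show T1 + (4 * ℓ - T1 - T2 - T3) + T2 + T3 = 4 * ℓ by ring] at p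
  have e2 : |∫ s in σ..τ, Real.sqrt (2 * V s)| ≤ c0 V := by
    rcases hσ with rfl | rfl <;> rcases hτ with rfl | rfl
    · simpa using hc0
    · rw [intervalIntegral.integral_symm, abs_neg]
      exact (abs_of_nonneg hc0).le
    · exact (abs_of_nonneg hc0).le
    · simpa using hc0
  rw [intervalIntegral.integral_symm, abs_neg] at eτ
  rw [eσ, eτ] at p
  obtain ⟨_, u, hu, u0, u1, hE⟩ := p
  have hs : energy V (-(2*ℓ)) (2*ℓ) (fun x => u (x + 2 * ℓ)) = energy V 0 (4 * ℓ) u := by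
    rw [energy_shift]; congr 1 <;> ring
  refine le_trans (csInf_le (a := energy V (-(2*ℓ)) (2*ℓ) (fun x => u (x + 2 * ℓ))) ⟨0, ?_⟩
    ⟨fun x => u (x + 2 * ℓ), hu.comp (contDiff_id.add contDiff_const),
    u0 _ (by linarith), u1 _ (by linarith), rfl⟩) ?_
  · rintro e ⟨v, -, -, -, rfl⟩
    refine intervalIntegral.integral_nonneg (by linarith) fun x _ => ?_
    have := hV.nonneg (v x)
    positivity
  · rw [hs]
    linarith
end
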